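/- arXiv:2410.17095 — 2 statements merged into one kernel-verified Lean document; each statement's English description precedes it below -/
import Mathlib

section
/- Fix ε>0 and a binary-secret prior with 0 < q_{s₁} ≤ q_{s₀} < 1, and let l* be the feasible dominant point. Define a mechanism P(T|S,Y) on 𝒯 = {t₁,t₂,t₃,t₄} by P(T=t₁|S=s₁,Y=1)=1; P(T=t_i|S=s₀,Y=1)=l*_i^{(0)}/q_{s₀} for i∈{1,2,3}; P(T=t₄|S=s₀,Y=0)=1; P(T=t_i|S=s₁,Y=0)=l*_i^{(1)}/(1−q_{s₁}) for i∈{2,3,4}; and all other conditional probabilities zero. Then these conditionals are a valid stochastic mechanism, the induced joint information structure P(S,Y,T) = P(T|S,Y)·P(S,Y) is ε-IP, satisfies P(T=t_i|S=s_j) = l*_i^{(j)} for all i,j, and for every convex u:[0,1]→ℝ it maximizes Σ_{t:P(T=t)>0} P(T=t)·u(P(Y=1|T=t)) among all ε-IP information structures (over all finite signal sets) with the given marginal P(S,Y). -/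
open Real
open scoped Classical

noncomputable section

namespace IPPaper

variable {S T : Type} [Fintype S] [Fintype T]

/-- Marginal probability of the secret `S`. -/
def pS (P : S → Bool → T → ℝ) (s : S) : ℝ := ∑ y, ∑ t, P s y t

/-- Marginal probability of the signal `T`. -/
def pT (P : S → Bool → T → ℝ) (t : T) : ℝ := ∑ s, ∑ y, P s y t

/-- Joint marginal on `(S,T)`. -/
def pST (P : S → Bool → T → ℝ) (s : S) (t : T) : ℝ := ∑ y, P s y t

/-- Joint marginal on `(Y,T)`. -/
def pYT (P : S → Bool → T → ℝ) (y : Bool) (t : T) : ℝ := ∑ s, P s y t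

/-- Joint marginal on `(S,Y)`. -/
def pSY (P : S → Bool → T → ℝ) (s : S) (y : Bool) : ℝ := ∑ t, P s y t

/-- An information structure: nonnegative, sums to one, every secret has positive
probability. -/
def InfoStructure (P : S → Bool → T → ℝ) : Prop :=
  (∀ s y t, 0 ≤ P s y t) ∧ (∑ s, ∑ y, ∑ t, P s y t) = 1 ∧ ∀ s, 0 < pS P s

/-- Conditional probability `P(T = t | S = s)`. -/
def condTS (P : S → Bool → T → ℝ) (t : T) (s : S) : ℝ := pST P s t / pS P s

/-- Conditional probability `P(S = s | T = t)`. -/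
def condST (P : S → Bool → T → ℝ) (s : S) (t : T) : ℝ := pST P s t / pT P t

/-- Posterior `P(Y = 1 | T = t)`. -/
def postYT (P : S → Bool → T → ℝ) (t : T) : ℝ := pYT P true t / pT P t

/-- Posterior `P(Y = 1 | S = s, T = t)`. -/
def postYST (P : S → Bool → T → ℝ) (s : S) (t : T) : ℝ := P s true t / pST P s t

/-- Prior conditional `P(Y = 1 | S = s)`. -/
def qS (P : S → Bool → T → ℝ) (s : S) : ℝ := pSY P s true / pS P s

/-- `ε`-inferential privacy. -/
def IsIP (ε : ℝ) (P : S → Bool → T → ℝ) : Prop :=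
  ∀ s₁ s₂ t, condTS P t s₁ ≤ Real.exp ε * condTS P t s₂

/-- Blackwell dominance via a row-stochastic garbling kernel. -/
def BlackwellDom {T₁ T₂ : Type} [Fintype T₁] [Fintype T₂]
    (Q₁ : Bool → T₁ → ℝ) (Q₂ : Bool → T₂ → ℝ) : Prop :=
  ∃ G : T₁ → T₂ → ℝ, (∀ a b, 0 ≤ G a b) ∧ (∀ a, ∑ b, G a b = 1) ∧
    ∀ y b, Q₂ y b = ∑ a, Q₁ y a * G a b

/-- `ε`-IP Blackwell optimality: no ε-IP information structure with the same
marginal on `(S,Y)` (over any finite signal set) strictly Blackwell dominates it. -/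
def BlackwellOptimal (ε : ℝ) (P : S → Bool → T → ℝ) : Prop :=
  InfoStructure P ∧ IsIP ε P ∧
  ¬ ∃ (n : ℕ) (P' : S → Bool → Fin n → ℝ),
      InfoStructure P' ∧ IsIP ε P' ∧ (∀ s y, pSY P' s y = pSY P s y) ∧
      BlackwellDom (pYT P') (pYT P) ∧ ¬ BlackwellDom (pYT P) (pYT P')

/-- Membership in `T̃`: signals with positive probability and nondegenerate posterior. -/
def inTildeT (P : S → Bool → T → ℝ) (t : T) : Prop :=
  0 < pT P t ∧ postYT P t ≠ 0 ∧ postYT P t ≠ 1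

/-- `L_t = min_s P(T=t|S=s)`. -/
def Lval [Nonempty S] (P : S → Bool → T → ℝ) (t : T) : ℝ :=
  Finset.univ.inf' Finset.univ_nonempty (fun s => condTS P t s)

/-- `H_t = max_s P(T=t|S=s)`. -/
def Hval [Nonempty S] (P : S → Bool → T → ℝ) (t : T) : ℝ :=
  Finset.univ.sup' Finset.univ_nonempty (fun s => condTS P t s)

/-- Expected utility `Σ_{t : P(T=t)>0} P(T=t)·u(P(Y=1|T=t))`. -/
def EU (P : S → Bool → T → ℝ) (u : ℝ → ℝ) : ℝ :=
  ∑ t ∈ Finset.univ.filter (fun t => 0 < pT P t), pT P t * u (postYT P t)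

end IPPaper

namespace IPPaper

/-- Feasibility conditions for the cell widths `l i j = P(T = t_{i+1} | S = s_j)`
(Lemma 5.1 of the paper), with parameters `ε`, `q0 = q_{s₀}`, `q1 = q_{s₁}`. -/
def Feasible (ε q0 q1 : ℝ) (l : Fin 4 → Fin 2 → ℝ) : Prop :=
  l 0 1 = q1 ∧ l 3 0 = 1 - q0 ∧
  l 1 0 = Real.exp ε * l 1 1 ∧ l 2 1 = Real.exp ε * l 2 0 ∧
  Real.exp (-ε) * l 0 1 ≤ l 0 0 ∧ l 0 0 ≤ Real.exp ε * l 0 1 ∧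
  Real.exp (-ε) * l 3 0 ≤ l 3 1 ∧ l 3 1 ≤ Real.exp ε * l 3 0 ∧
  (∀ j : Fin 2, ∑ i : Fin 4, l i j = 1) ∧
  (∀ (i : Fin 4) (j : Fin 2), 0 ≤ l i j)

/-- The feasible dominant point: feasible and simultaneously maximizing
`l₁^{(0)}` and `l₄^{(1)}` among feasible points. -/
def DominantPoint (ε q0 q1 : ℝ) (l : Fin 4 → Fin 2 → ℝ) : Prop :=
  Feasible ε q0 q1 l ∧
  ∀ l', Feasible ε q0 q1 l' → l' 0 0 ≤ l 0 0 ∧ l' 3 1 ≤ l 3 1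

/-- Expected utility associated to a feasible point: signal probabilities
`p_{t_i} = π₀·l_i^{(0)} + π₁·l_i^{(1)}` and posteriors
`q_{t₁}=1`, `q_{t₂}=e^ε·π₀/(e^ε·π₀+π₁)`, `q_{t₃}=π₀/(π₀+e^ε·π₁)`, `q_{t₄}=0`. -/
def Ufun (ε π0 π1 : ℝ) (u : ℝ → ℝ) (l : Fin 4 → Fin 2 → ℝ) : ℝ :=
  (π0 * l 0 0 + π1 * l 0 1) * u 1 +
  (π0 * l 1 0 + π1 * l 1 1) * u (Real.exp ε * π0 / (Real.exp ε * π0 + π1)) +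
  (π0 * l 2 0 + π1 * l 2 1) * u (π0 / (π0 + Real.exp ε * π1)) +
  (π0 * l 3 0 + π1 * l 3 1) * u 0

end IPPaper

namespace IPPaper

/-- Jensen gap of `u`, in homogeneous form: the utility lost by not revealing the state at a
signal carrying mass `N` on `Y = 1` and mass `K` on `Y = 0`. -/
def revealGap (u : ℝ → ℝ) (N K : ℝ) : ℝ := N * u 1 + K * u 0 - (N + K) * u (N / (N + K))

theorem revealGap_smul (u : ℝ → ℝ) (c N K : ℝ) :
    revealGap u (c * N) (c * K) = c * revealGap u N K := by
  unfold revealGap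
  rcases eq_or_ne c 0 with rfl | hc
  · simp
  · rw [← mul_add, mul_div_mul_left _ _ hc]
    ring

theorem revealGap_zero_right (u : ℝ → ℝ) (N : ℝ) : revealGap u N 0 = 0 := by
  rcases eq_or_ne N 0 with rfl | h <;> simp [revealGap, *]

theorem revealGap_zero_left (u : ℝ → ℝ) (K : ℝ) : revealGap u 0 K = 0 := by
  simp [revealGap]

theorem revealGap_superadditive {u : ℝ → ℝ} (hu : ConvexOn ℝ (Set.Icc 0 1) u) {N K N' K' : ℝ}
    (hN : 0 ≤ N) (hK : 0 ≤ K) (hN' : 0 ≤ N') (hK' : 0 ≤ K') :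
    revealGap u N K + revealGap u N' K' ≤ revealGap u (N + N') (K + K') := by
  rcases (add_nonneg hN hK).eq_or_lt with h | h
  · obtain ⟨rfl, rfl⟩ : N = 0 ∧ K = 0 := ⟨by linarith, by linarith⟩
    simp [revealGap]
  rcases (add_nonneg hN' hK').eq_or_lt with h' | h'
  · obtain ⟨rfl, rfl⟩ : N' = 0 ∧ K' = 0 := ⟨by linarith, by linarith⟩
    simp [revealGap]
  have hs : 0 < N + K + (N' + K') := by linarith
  have hx : N / (N + K) ∈ Set.Icc (0 : ℝ) 1 := ⟨by positivity, by rw [div_le_one h]; linarith⟩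
  have hx' : N' / (N' + K') ∈ Set.Icc (0 : ℝ) 1 :=
    ⟨by positivity, by rw [div_le_one h']; linarith⟩
  have hw : 0 ≤ (N + K) / (N + K + (N' + K')) := by positivity
  have hw' : 0 ≤ (N' + K') / (N + K + (N' + K')) := by positivity
  have key := hu.2 hx hx' hw hw' (by field_simp)
  have harg : (N + K) / (N + K + (N' + K')) * (N / (N + K)) +
      (N' + K') / (N + K + (N' + K')) * (N' / (N' + K')) =
      (N + N') / (N + N' + (K + K')) := by
    rw [show N + N' + (K + K') = N + K + (N' + K') by ring]
    field_simp
  simp only [smul_eq_mul] at key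
  rw [harg] at key
  have hmul := mul_le_mul_of_nonneg_left key hs.le
  have hsplit : (N + K + (N' + K')) * ((N + K) / (N + K + (N' + K')) * u (N / (N + K)) +
      (N' + K') / (N + K + (N' + K')) * u (N' / (N' + K'))) =
      (N + K) * u (N / (N + K)) + (N' + K') * u (N' / (N' + K')) := by
    field_simp
  rw [hsplit] at hmul
  unfold revealGap
  rw [show N + N' + (K + K') = N + K + (N' + K') by ring] at hmul ⊢
  linarith

/-- Lower bound for a superadditive homogeneous function on the quadrant by the values at the
two extreme directions `(E, 1)` and `(1, E)`. -/
theorem superadditive_lower_bound {ψ : ℝ → ℝ → ℝ} {E a b : ℝ} (hE : 1 < E)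
    (hadd : ∀ N K N' K', 0 ≤ N → 0 ≤ K → 0 ≤ N' → 0 ≤ K' →
      ψ N K + ψ N' K' ≤ ψ (N + N') (K + K'))
    (hsmul : ∀ c N K, ψ (c * N) (c * K) = c * ψ N K)
    (hright : ∀ N, ψ N 0 = 0) (hleft : ∀ K, ψ 0 K = 0)
    (ha : 0 ≤ a) (hb : 0 ≤ b) (h₁ : E * a + b ≤ ψ E 1) (h₂ : a + E * b ≤ ψ 1 E)
    {X Y Z W N K : ℝ} (hX : 0 ≤ X) (hY : 0 ≤ Y) (hZ : 0 ≤ Z) (hW : 0 ≤ W)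
    (hXN : X ≤ N) (hWK : W ≤ K)
    (hXY : X + Y ≤ E * (Z + W)) (hZW : Z + W ≤ E * (X + Y)) :
    a * (X - E * Z) + b * (W - E * Y) ≤ ψ N K := by
  have hN := hX.trans hXN
  have hK := hW.trans hWK
  have hEZ : 0 ≤ E * Z := by positivity
  have hEY : 0 ≤ E * Y := by positivity
  by_cases hl : E * N ≤ K
  · have h := hadd (N * 1) (N * E) 0 (K - N * E) (by linarith) (by positivity) le_rfl
      (by linarith)
    rw [hsmul, hleft, show N * 1 + 0 = N by ring, show N * E + (K - N * E) = K by ring] at h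
    have e₁ := mul_le_mul_of_nonneg_left h₂ hN
    have e₂ := mul_le_mul_of_nonneg_left hXN ha
    have e₃ := mul_le_mul_of_nonneg_left hXN (by positivity : 0 ≤ E * b)
    have e₄ := mul_le_mul_of_nonneg_left (by linarith : W - E * Y ≤ E * X) hb
    have e₅ := mul_le_mul_of_nonneg_left (by linarith : X - E * Z ≤ X) ha
    linarith
  by_cases hr : E * K ≤ N
  · have h := hadd (K * E) (K * 1) (N - K * E) 0 (by positivity) (by linarith)
      (by linarith) le_rfl
    rw [hsmul, hright, show K * E + (N - K * E) = N by ring, show K * 1 + 0 = K by ring] at h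
    have e₁ := mul_le_mul_of_nonneg_left h₁ hK
    have e₂ := mul_le_mul_of_nonneg_left hWK hb
    have e₃ := mul_le_mul_of_nonneg_left hWK (by positivity : 0 ≤ E * a)
    have e₄ := mul_le_mul_of_nonneg_left (by linarith : X - E * Z ≤ E * W) ha
    have e₅ := mul_le_mul_of_nonneg_left (by linarith : W - E * Y ≤ W) hb
    linarith
  · push Not at hl hr
    have hD : 0 < E ^ 2 - 1 := by nlinarith
    obtain ⟨s, hs⟩ : ∃ s, s = (E * N - K) / (E ^ 2 - 1) := ⟨_, rfl⟩
    obtain ⟨t, ht⟩ : ∃ t, t = (E * K - N) / (E ^ 2 - 1) := ⟨_, rfl⟩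
    have hs0 : 0 ≤ s := hs ▸ div_nonneg (by linarith) hD.le
    have ht0 : 0 ≤ t := ht ▸ div_nonneg (by linarith) hD.le
    have hNst : s * E + t * 1 = N := by rw [hs, ht]; field_simp; ring
    have hKst : s * 1 + t * E = K := by rw [hs, ht]; field_simp; ring
    have h := hadd (s * E) (s * 1) (t * 1) (t * E) (by positivity) (by positivity)
      (by positivity) (by positivity)
    rw [hsmul, hsmul, hNst, hKst] at h
    have e₁ := mul_le_mul_of_nonneg_left h₁ hs0
    have e₂ := mul_le_mul_of_nonneg_left h₂ ht0
    have e₃ := mul_le_mul_of_nonneg_left (by linarith : X - E * Z ≤ N) ha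
    have e₄ := mul_le_mul_of_nonneg_left (by linarith : W - E * Y ≤ K) hb
    have e₅ : s * (E * a + b) + t * (a + E * b) = a * N + b * K := by
      rw [← hNst, ← hKst]; ring
    linarith

theorem pT_eq_pYT {S T : Type} [Fintype S] (P : S → Bool → T → ℝ) (t : T) : pT P t = pYT P true t + pYT P false t := by
  simp [pT, pYT, Finset.sum_add_distrib]

theorem sum_pYT {S T : Type} [Fintype S] [Fintype T] (P : S → Bool → T → ℝ) (y : Bool) : ∑ t, pYT P y t = ∑ s, pSY P s y := by
  simp only [pYT, pSY]
  exact Finset.sum_comm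

theorem pS_eq_pSY {S T : Type} [Fintype S] [Fintype T] (P : S → Bool → T → ℝ) (s : S) : pS P s = pSY P s true + pSY P s false := by
  simp [pS, pSY]

theorem EU_eq_sub_revealGap {S T : Type} [Fintype S] [Fintype T] {P : S → Bool → T → ℝ} (hP : ∀ s y t, 0 ≤ P s y t) (u : ℝ → ℝ) :
    EU P u = (∑ s, pSY P s true) * u 1 + (∑ s, pSY P s false) * u 0 -
      ∑ t, revealGap u (pYT P true t) (pYT P false t) := by
  have hT : ∀ t, 0 ≤ pT P t := fun t =>
    Finset.sum_nonneg fun s _ => Finset.sum_nonneg fun y _ => hP s y t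
  have hEU : EU P u = ∑ t, pT P t * u (postYT P t) := by
    unfold EU
    refine Finset.sum_filter_of_ne fun t _ h => (hT t).lt_of_ne fun h0 => h ?_
    rw [← h0, zero_mul]
  rw [hEU, ← sum_pYT, ← sum_pYT, Finset.sum_mul, Finset.sum_mul, ← Finset.sum_add_distrib,
    ← Finset.sum_sub_distrib]
  refine Finset.sum_congr rfl fun t _ => ?_
  rw [revealGap, postYT, pT_eq_pYT]
  ring

/-- The losses `m`, `n` of a dominant point minimise both linear forms `E * m + n`
and `m + E * n` over the feasible pairs. -/
theorem DominantPoint.le_of_feasible {ε q0 q1 : ℝ} (hq1 : 0 < q1) (hq0 : q0 < 1)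
    {l : Fin 4 → Fin 2 → ℝ} (hl : DominantPoint ε q0 q1 l) {m n : ℝ}
    (hm : 0 ≤ m) (hn : 0 ≤ n)
    (hA : q0 - Real.exp ε * q1 ≤ Real.exp ε * m + n)
    (hA' : Real.exp ε * m + n ≤ q0 - (Real.exp ε)⁻¹ * q1)
    (hB : (1 - q1) - Real.exp ε * (1 - q0) ≤ m + Real.exp ε * n)
    (hB' : m + Real.exp ε * n ≤ (1 - q1) - (Real.exp ε)⁻¹ * (1 - q0)) :
    Real.exp ε * l 1 1 + l 2 0 ≤ Real.exp ε * m + n ∧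
      l 1 1 + Real.exp ε * l 2 0 ≤ m + Real.exp ε * n := by
  obtain ⟨⟨hf1, hf2, hf3, hf4, -, -, -, -, hsum, -⟩, hdom⟩ := hl
  have s0 := hsum 0
  have s1 := hsum 1
  rw [Fin.sum_univ_four] at s0 s1
  have hEi : 0 < (Real.exp ε)⁻¹ := by positivity
  have hEq : 0 < (Real.exp ε)⁻¹ * q1 := by positivity
  have hEq' : 0 < (Real.exp ε)⁻¹ * (1 - q0) := mul_pos hEi (by linarith)
  have hEm : 0 ≤ Real.exp ε * m := by positivity
  have hEn : 0 ≤ Real.exp ε * n := by positivity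
  have hfeas : Feasible ε q0 q1 ![![q0 - Real.exp ε * m - n, q1], ![Real.exp ε * m, m],
      ![n, Real.exp ε * n], ![1 - q0, 1 - q1 - m - Real.exp ε * n]] := by
    refine ⟨rfl, rfl, rfl, rfl, ?_, ?_, ?_, ?_, ?_, ?_⟩
    · simp [Real.exp_neg]; linarith
    · simp; linarith
    · simp [Real.exp_neg]; linarith
    · simp; linarith
    · intro j
      fin_cases j <;> rw [Fin.sum_univ_four] <;>
        simp only [Matrix.cons_val, Fin.zero_eta, Fin.mk_one] <;> ring
    · intro i j
      fin_cases i <;> fin_cases j <;> simp <;> linarith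
  have h := hdom _ hfeas
  simp at h
  constructor <;> linarith [h.1, h.2]

/-- Linear-programming duality for minimising `m * U₁ + n * U₂`: a feasible pair minimising both
forms `E * m + n` and `m + E * n` admits dual multipliers certifying its value. -/
theorem exists_multipliers {E A B A' B' m n U₁ U₂ : ℝ} (hE : 1 < E)
    (hm : 0 ≤ m) (hn : 0 ≤ n) (hmA : A ≤ E * m + n) (hmB : B ≤ m + E * n)
    (hmin : ∀ m' n' : ℝ, 0 ≤ m' → 0 ≤ n' → A ≤ E * m' + n' → E * m' + n' ≤ A' →
      B ≤ m' + E * n' → m' + E * n' ≤ B' →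
      E * m + n ≤ E * m' + n' ∧ m + E * n ≤ m' + E * n')
    (hA : A ≤ A') (hB : B ≤ B') (hA0 : 0 ≤ A') (hB0 : 0 ≤ B')
    (hAB' : E⁻¹ * A ≤ B') (hBA' : E⁻¹ * B ≤ A')
    (hU₁ : 0 ≤ U₁) (hU₂ : 0 ≤ U₂) (h₁₂ : U₁ ≤ E * U₂) (h₂₁ : U₂ ≤ E * U₁) :
    ∃ a b, 0 ≤ a ∧ 0 ≤ b ∧ E * a + b ≤ U₁ ∧ a + E * b ≤ U₂ ∧
      m * U₁ + n * U₂ ≤ a * A + b * B := by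
  have hEpos : 0 < E := by linarith
  have hD : 0 < E ^ 2 - 1 := by nlinarith
  have hcancel : ∀ x : ℝ, E * (E⁻¹ * x) = x := fun x => mul_inv_cancel_left₀ hEpos.ne' x
  have hle : ∀ x y : ℝ, x ≤ E * y → E⁻¹ * x ≤ y := fun x y h => by
    rwa [inv_mul_le_iff₀ hEpos]
  have hle' : ∀ x y : ℝ, E * x ≤ y → x ≤ E⁻¹ * y := fun x y h => by
    rwa [le_inv_mul_iff₀ hEpos]
  have hEm : m ≤ E * m := le_mul_of_one_le_left hm hE.le
  have hEn : n ≤ E * n := le_mul_of_one_le_left hn hE.le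
  by_cases h0 : A ≤ 0 ∧ B ≤ 0
  · obtain ⟨h, -⟩ := hmin 0 0 le_rfl le_rfl (by linarith) (by linarith) (by linarith)
      (by linarith)
    obtain rfl : m = 0 := by linarith
    obtain rfl : n = 0 := by linarith
    exact ⟨0, 0, le_rfl, le_rfl, by simpa, by simpa, by simp⟩
  by_cases hAB : E * B ≤ A
  · have hApos : 0 < A := by
      by_contra hneg
      exact h0 ⟨by linarith, nonpos_of_mul_nonpos_right (by linarith : E * B ≤ 0) hEpos⟩
    obtain ⟨h, h'⟩ := hmin (E⁻¹ * A) 0 (by positivity) le_rfl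
      (by rw [hcancel]; linarith) (by rw [hcancel]; linarith)
      (by linarith [hle' _ _ hAB]) (by linarith)
    rw [hcancel] at h
    have h'' := mul_le_mul_of_nonneg_left h' hEpos.le
    rw [mul_add, mul_add, hcancel] at h''
    have hn0 : n = 0 := by
      have : (E ^ 2 - 1) * n ≤ 0 := by linarith
      exact le_antisymm (nonpos_of_mul_nonpos_right this hD) hn
    subst hn0
    have hmE : m = E⁻¹ * A := by
      rw [eq_inv_mul_iff_mul_eq₀ hEpos.ne']
      linarith
    refine ⟨E⁻¹ * U₁, 0, by positivity, le_rfl, ?_, ?_, ?_⟩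
    · rw [hcancel, add_zero]
    · linarith [hle _ _ h₁₂]
    · rw [hmE]; linarith
  by_cases hBA : E * A ≤ B
  · have hBpos : 0 < B := by
      by_contra hneg
      exact h0 ⟨nonpos_of_mul_nonpos_right (by linarith : E * A ≤ 0) hEpos, by linarith⟩
    obtain ⟨h, h'⟩ := hmin 0 (E⁻¹ * B) le_rfl (by positivity)
      (by linarith [hle' _ _ hBA]) (by linarith)
      (by rw [hcancel]; linarith) (by rw [hcancel]; linarith)
    rw [hcancel] at h'
    have h'' := mul_le_mul_of_nonneg_left h hEpos.le
    rw [mul_add, mul_add, hcancel] at h''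
    have hm0 : m = 0 := by
      have : (E ^ 2 - 1) * m ≤ 0 := by linarith
      exact le_antisymm (nonpos_of_mul_nonpos_right this hD) hm
    subst hm0
    have hnE : n = E⁻¹ * B := by
      rw [eq_inv_mul_iff_mul_eq₀ hEpos.ne']
      linarith
    refine ⟨0, E⁻¹ * U₂, le_rfl, by positivity, ?_, ?_, ?_⟩
    · linarith [hle _ _ h₂₁]
    · rw [hcancel, zero_add]
    · rw [hnE]; linarith
  · push Not at hAB hBA
    have e₁ : ∀ x y : ℝ, E * ((E * x - y) / (E ^ 2 - 1)) + (E * y - x) / (E ^ 2 - 1) = x := by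
      intro x y; field_simp; ring
    have e₂ : ∀ x y : ℝ, (E * x - y) / (E ^ 2 - 1) + E * ((E * y - x) / (E ^ 2 - 1)) = y := by
      intro x y; field_simp; ring
    have h := hmin ((E * A - B) / (E ^ 2 - 1)) ((E * B - A) / (E ^ 2 - 1))
      (div_nonneg (by linarith) hD.le) (div_nonneg (by linarith) hD.le)
      (e₁ A B).ge (by rwa [e₁]) (e₂ A B).ge (by rwa [e₂])
    rw [e₁, e₂] at h
    refine ⟨(E * U₁ - U₂) / (E ^ 2 - 1), (E * U₂ - U₁) / (E ^ 2 - 1),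
      div_nonneg (by linarith) hD.le, div_nonneg (by linarith) hD.le,
      (e₁ U₁ U₂).le, (e₂ U₁ U₂).le, ?_⟩
    rw [le_antisymm hmA h.1, le_antisymm hmB h.2]
    refine le_of_eq ?_
    field_simp
    ring

theorem DominantPoint.exists_multipliers {ε q0 q1 : ℝ} (hε : 0 < ε) (hq1 : 0 < q1)
    (hq01 : q1 ≤ q0) (hq0 : q0 < 1) {l : Fin 4 → Fin 2 → ℝ} (hl : DominantPoint ε q0 q1 l)
    {U₁ U₂ : ℝ} (hU₁ : 0 ≤ U₁) (hU₂ : 0 ≤ U₂)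
    (h₁₂ : U₁ ≤ Real.exp ε * U₂) (h₂₁ : U₂ ≤ Real.exp ε * U₁) :
    ∃ a b, 0 ≤ a ∧ 0 ≤ b ∧ Real.exp ε * a + b ≤ U₁ ∧ a + Real.exp ε * b ≤ U₂ ∧
      l 1 1 * U₁ + l 2 0 * U₂ ≤
        a * (q0 - Real.exp ε * q1) + b * ((1 - q1) - Real.exp ε * (1 - q0)) := by
  have hE : 1 < Real.exp ε := Real.one_lt_exp_iff.2 hε
  have hcancel : ∀ x : ℝ, (Real.exp ε)⁻¹ * (Real.exp ε * x) = x := fun x =>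
    inv_mul_cancel_left₀ (by positivity) x
  have hinv : (Real.exp ε)⁻¹ < 1 := inv_lt_one_of_one_lt₀ hE
  have hmul : ∀ x : ℝ, 0 ≤ x → x ≤ Real.exp ε * x := fun x hx =>
    le_mul_of_one_le_left hx hE.le
  have hmul' : ∀ x : ℝ, 0 ≤ x → (Real.exp ε)⁻¹ * x ≤ x := fun x hx =>
    mul_le_of_le_one_left hx hinv.le
  have i₁ := hmul q1 hq1.le
  have i₂ := hmul (1 - q0) (by linarith)
  have i₃ := hmul' q1 hq1.le
  have i₄ := hmul' (1 - q0) (by linarith)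
  obtain ⟨hf1, hf2, hf3, hf4, -, hf6, -, hf8, hsum, hnn⟩ := hl.1
  have s0 := hsum 0
  have s1 := hsum 1
  rw [Fin.sum_univ_four] at s0 s1
  rw [hf1] at hf6
  rw [hf2] at hf8
  refine IPPaper.exists_multipliers hE (hnn 1 1) (hnn 2 0) (by linarith) (by linarith)
    (fun m n => hl.le_of_feasible hq1 hq0) (by linarith) (by linarith) (by linarith)
    (by linarith) ?_ ?_ hU₁ hU₂ h₁₂ h₂₁
  · rw [mul_sub, hcancel, mul_sub, mul_one]
    linarith
  · rw [mul_sub, hcancel, mul_sub, mul_one]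
    linarith

/-- the mechanism induced by the feasible dominant point is a
valid stochastic mechanism; the induced joint structure is ε-IP, has
conditionals `P(T=t_i|S=s_j) = l*_i^{(j)}`, and universally maximizes expected
utility among ε-IP information structures with the given prior. -/
theorem statement7 (ε : ℝ) (hε : 0 < ε)
    (Pr : Fin 2 → Bool → ℝ)
    (hPr : ∀ s y, 0 ≤ Pr s y) (hPrsum : ∑ s, ∑ y, Pr s y = 1)
    (hπ : ∀ s : Fin 2, 0 < Pr s true + Pr s false)
    (q0 q1 : ℝ)
    (hq0 : q0 = Pr 0 true / (Pr 0 true + Pr 0 false))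
    (hq1 : q1 = Pr 1 true / (Pr 1 true + Pr 1 false))
    (hq1pos : 0 < q1) (hq01 : q1 ≤ q0) (hq0lt : q0 < 1)
    (l : Fin 4 → Fin 2 → ℝ) (hl : DominantPoint ε q0 q1 l)
    -- the mechanism P(T = t | S = s, Y = y)
    (M : Fin 4 → Fin 2 → Bool → ℝ)
    (hM1 : M 0 1 true = 1)
    (hM2 : ∀ i : Fin 4, i ≠ 0 → M i 1 true = 0)
    (hM3 : ∀ i : Fin 4, i ≠ 3 → M i 0 true = l i 0 / q0)
    (hM4 : M 3 0 true = 0)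
    (hM5 : M 3 0 false = 1)
    (hM6 : ∀ i : Fin 4, i ≠ 3 → M i 0 false = 0)
    (hM7 : ∀ i : Fin 4, i ≠ 0 → M i 1 false = l i 1 / (1 - q1))
    (hM8 : M 0 1 false = 0)
    -- the induced joint information structure
    (P : Fin 2 → Bool → Fin 4 → ℝ)
    (hP : ∀ s y t, P s y t = Pr s y * M t s y) :
    (∀ t s y, 0 ≤ M t s y) ∧
    (∀ s y, ∑ t, M t s y = 1) ∧
    InfoStructure P ∧ IsIP ε P ∧
    (∀ s y, pSY P s y = Pr s y) ∧
    (∀ (t : Fin 4) (s : Fin 2), condTS P t s = l t s) ∧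
    (∀ u : ℝ → ℝ, ConvexOn ℝ (Set.Icc 0 1) u →
      ∀ (n : ℕ) (P' : Fin 2 → Bool → Fin n → ℝ),
        InfoStructure P' → IsIP ε P' → (∀ s y, pSY P' s y = Pr s y) →
        EU P' u ≤ EU P u) := by
  obtain ⟨hf1, hf2, hf3, hf4, hf5, hf6, hf7, hf8, hsum, hnn⟩ := hl.1
  have hE : 1 < Real.exp ε := Real.one_lt_exp_iff.2 hε
  have hq0pos : 0 < q0 := hq1pos.trans_le hq01
  have hq1lt : q1 < 1 := hq01.trans_lt hq0lt
  obtain ⟨π0, hπ0⟩ : ∃ x, x = Pr 0 true + Pr 0 false := ⟨_, rfl⟩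
  obtain ⟨π1, hπ1⟩ : ∃ x, x = Pr 1 true + Pr 1 false := ⟨_, rfl⟩
  have p0 : 0 < π0 := hπ0 ▸ hπ 0
  have p1 : 0 < π1 := hπ1 ▸ hπ 1
  rw [← hπ0, eq_div_iff p0.ne'] at hq0
  rw [← hπ1, eq_div_iff p1.ne'] at hq1
  have r0t : Pr 0 true = π0 * q0 := by linarith
  have r0f : Pr 0 false = π0 * (1 - q0) := by linarith
  have r1t : Pr 1 true = π1 * q1 := by linarith
  have r1f : Pr 1 false = π1 * (1 - q1) := by linarith
  have s0 := hsum 0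
  have s1 := hsum 1
  rw [Fin.sum_univ_four] at s0 s1
  have hq1' : 0 < 1 - q1 := by linarith
  have M0t : ∀ t, M t 0 true = if t = 3 then 0 else l t 0 / q0 := by
    intro t; split_ifs with h
    · rw [h, hM4]
    · exact hM3 t h
  have M0f : ∀ t, M t 0 false = if t = 3 then 1 else 0 := by
    intro t; split_ifs with h
    · rw [h, hM5]
    · exact hM6 t h
  have M1t : ∀ t, M t 1 true = if t = 0 then 1 else 0 := by
    intro t; split_ifs with h
    · rw [h, hM1]
    · exact hM2 t h
  have M1f : ∀ t, M t 1 false = if t = 0 then 0 else l t 1 / (1 - q1) := by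
    intro t; split_ifs with h
    · rw [h, hM8]
    · exact hM7 t h
  have hMnn : ∀ t s y, 0 ≤ M t s y := by
    intro t s y
    have h0 := hnn t 0
    have h1 := hnn t 1
    fin_cases s <;> cases y <;> simp only [Fin.zero_eta, Fin.mk_one, M0t, M0f, M1t, M1f] <;>
      split_ifs <;> positivity
  have hMsum : ∀ s y, ∑ t, M t s y = 1 := by
    intro s y
    fin_cases s <;> cases y <;> simp [Fin.sum_univ_four, M0t, M0f, M1t, M1f] <;>
      field_simp <;> linarith
  have hSY : ∀ s y, pSY P s y = Pr s y := by
    intro s y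
    simp only [pSY, hP, ← Finset.mul_sum, hMsum, mul_one]
  have hS0 : pS P 0 = π0 := by rw [pS_eq_pSY, hSY, hSY, hπ0]
  have hS1 : pS P 1 = π1 := by rw [pS_eq_pSY, hSY, hSY, hπ1]
  have hPnn : ∀ s y t, 0 ≤ P s y t := fun s y t => by
    rw [hP]; exact mul_nonneg (hPr s y) (hMnn t s y)
  have hcond : ∀ (t : Fin 4) (s : Fin 2), condTS P t s = l t s := by
    intro t s
    fin_cases s
    · simp only [Fin.zero_eta, condTS, hS0, pST, Fintype.sum_bool, hP, r0t, r0f, M0t, M0f]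
      split_ifs with h
      · subst h; rw [hf2]; field_simp; ring
      · field_simp; ring
    · simp only [Fin.mk_one, condTS, hS1, pST, Fintype.sum_bool, hP, r1t, r1f, M1t, M1f]
      split_ifs with h
      · subst h; rw [hf1]; field_simp; ring
      · field_simp; ring
  have hexp : ∀ {x y : ℝ}, Real.exp (-ε) * x ≤ y → x ≤ Real.exp ε * y := fun h => by
    rwa [Real.exp_neg, inv_mul_le_iff₀ (Real.exp_pos ε)] at h
  have hself : ∀ {x : ℝ}, 0 ≤ x → x ≤ Real.exp ε * x := fun hx =>
    le_mul_of_one_le_left hx hE.le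
  have hself₂ : ∀ {x : ℝ}, 0 ≤ x → x ≤ Real.exp ε * (Real.exp ε * x) := fun hx =>
    (hself hx).trans (hself (mul_nonneg (Real.exp_pos ε).le hx))
  refine ⟨hMnn, hMsum, ⟨hPnn, ?_, ?_⟩, ?_, hSY, hcond, ?_⟩
  · rw [← hPrsum]
    exact Finset.sum_congr rfl fun s _ => Finset.sum_congr rfl fun y _ => hSY s y
  · intro s
    fin_cases s
    · exact hS0 ▸ p0
    · exact hS1 ▸ p1
  · intro s s' t
    rw [hcond, hcond]
    rcases eq_or_ne s s' with rfl | hne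
    · exact hself (hnn t s)
    have hpair : l t 0 ≤ Real.exp ε * l t 1 ∧ l t 1 ≤ Real.exp ε * l t 0 := by
      fin_cases t
      · exact ⟨hf6, hexp hf5⟩
      · exact ⟨hf3.le, hf3 ▸ hself₂ (hnn 1 1)⟩
      · exact ⟨hf4 ▸ hself₂ (hnn 2 0), hf4.le⟩
      · exact ⟨hexp hf7, hf8⟩
    fin_cases s <;> fin_cases s' <;> first | exact absurd rfl hne | exact hpair.1 | exact hpair.2
  intro u hu n P' hP' hIP' hSY'
  rw [EU_eq_sub_revealGap hP'.1, EU_eq_sub_revealGap hPnn]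
  simp only [hSY, hSY']
  refine sub_le_sub_left ?_ _
  obtain ⟨ψ, hψ⟩ : ∃ ψ : ℝ → ℝ → ℝ, ∀ N K, ψ N K = revealGap u (π0 * N) (π1 * K) :=
    ⟨_, fun _ _ => rfl⟩
  have hadd : ∀ N K N' K', 0 ≤ N → 0 ≤ K → 0 ≤ N' → 0 ≤ K' →
      ψ N K + ψ N' K' ≤ ψ (N + N') (K + K') := by
    intro N K N' K' hN hK hN' hK'
    rw [hψ, hψ, hψ, mul_add, mul_add]
    exact revealGap_superadditive hu (by positivity) (by positivity) (by positivity)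
      (by positivity)
  have hsmul : ∀ c N K, ψ (c * N) (c * K) = c * ψ N K := by
    intro c N K
    rw [hψ, hψ, mul_left_comm π0, mul_left_comm π1, revealGap_smul]
  have hright : ∀ N, ψ N 0 = 0 := fun N => by rw [hψ, mul_zero, revealGap_zero_right]
  have hleft : ∀ K, ψ 0 K = 0 := fun K => by rw [hψ, mul_zero, revealGap_zero_left]
  have hmono : ∀ N K N' K', 0 ≤ N → 0 ≤ K → N ≤ N' → K ≤ K' → ψ N K ≤ ψ N' K' := by
    intro N K N' K' hN hK hNN hKK
    have h₁ := hadd N K 0 (K' - K) hN hK le_rfl (by linarith)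
    have h₂ := hadd N K' (N' - N) 0 hN (hK.trans hKK) (by linarith) le_rfl
    rw [hleft, add_zero, add_zero, add_sub_cancel] at h₁
    rw [hright, add_zero, add_zero, add_sub_cancel] at h₂
    exact h₁.trans h₂
  have hEpos : 0 < Real.exp ε := Real.exp_pos ε
  have hψ1 : Real.exp ε * ψ (Real.exp ε) 1 =
      ψ (Real.exp ε * Real.exp ε) (Real.exp ε) := by rw [← hsmul, mul_one]
  have hψ2 : Real.exp ε * ψ 1 (Real.exp ε) =
      ψ (Real.exp ε) (Real.exp ε * Real.exp ε) := by rw [← hsmul, mul_one]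
  obtain ⟨a, b, ha, hb, hab₁, hab₂, hval⟩ := hl.exists_multipliers hε hq1pos hq01 hq0lt
    (U₁ := ψ (Real.exp ε) 1) (U₂ := ψ 1 (Real.exp ε))
    ((hleft 0).ge.trans (hmono _ _ _ _ le_rfl le_rfl hEpos.le zero_le_one))
    ((hleft 0).ge.trans (hmono _ _ _ _ le_rfl le_rfl zero_le_one hEpos.le))
    (by rw [hψ2]; exact hmono _ _ _ _ hEpos.le zero_le_one le_rfl (by nlinarith))
    (by rw [hψ1]; exact hmono _ _ _ _ zero_le_one hEpos.le (by nlinarith) le_rfl)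
  have hgap : ∑ t, revealGap u (pYT P true t) (pYT P false t) =
      l 1 1 * ψ (Real.exp ε) 1 + l 2 0 * ψ 1 (Real.exp ε) := by
    have e0 : pYT P false 0 = 0 := by simp [pYT, hP, M0f, M1f]
    have e1 : pYT P true 1 = π0 * (l 1 1 * Real.exp ε) := by
      simp [pYT, hP, M0t, M1t, hf3, r0t]; field_simp
    have e1' : pYT P false 1 = π1 * (l 1 1 * 1) := by
      simp [pYT, hP, M0f, M1f, r1f]; field_simp
    have e2 : pYT P true 2 = π0 * (l 2 0 * 1) := by
      simp [pYT, hP, M0t, M1t, r0t]; field_simp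
    have e2' : pYT P false 2 = π1 * (l 2 0 * Real.exp ε) := by
      simp [pYT, hP, M0f, M1f, r1f, hf4]; field_simp
    have e3 : pYT P true 3 = 0 := by simp [pYT, hP, M0t, M1t]
    rw [Fin.sum_univ_four, e0, e1, e1', e2, e2', e3, revealGap_zero_right, revealGap_zero_left,
      ← hψ, ← hψ, hsmul, hsmul]
    ring
  have hS0' : pS P' 0 = π0 := by rw [pS_eq_pSY, hSY', hSY', hπ0]
  have hS1' : pS P' 1 = π1 := by rw [pS_eq_pSY, hSY', hSY', hπ1]
  have hbound : ∀ t, a * (P' 0 true t / π0 - Real.exp ε * (P' 1 true t / π1)) +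
      b * (P' 1 false t / π1 - Real.exp ε * (P' 0 false t / π0)) ≤
      revealGap u (pYT P' true t) (pYT P' false t) := by
    intro t
    have x := hP'.1 0 true t
    have y := hP'.1 0 false t
    have z := hP'.1 1 true t
    have w := hP'.1 1 false t
    have ip := hIP' 0 1 t
    have ip' := hIP' 1 0 t
    simp only [condTS, pST, Fintype.sum_bool, hS0', hS1', add_div] at ip ip'
    have h := superadditive_lower_bound hE hadd hsmul hright hleft ha hb hab₁ hab₂
      (N := (P' 0 true t + P' 1 true t) / π0) (K := (P' 0 false t + P' 1 false t) / π1)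
      (div_nonneg x p0.le) (div_nonneg y p0.le) (div_nonneg z p1.le) (div_nonneg w p1.le)
      (by gcongr; linarith) (by gcongr; linarith) ip ip'
    rw [hψ, mul_div_cancel₀ _ p0.ne', mul_div_cancel₀ _ p1.ne'] at h
    simpa only [pYT, Fin.sum_univ_two] using h
  rw [hgap]
  refine hval.trans (le_trans (le_of_eq ?_) (Finset.sum_le_sum fun t _ => hbound t))
  have t0t : ∑ t, P' 0 true t = π0 * q0 := by rw [← r0t, ← hSY', pSY]
  have t0f : ∑ t, P' 0 false t = π0 * (1 - q0) := by rw [← r0f, ← hSY', pSY]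
  have t1t : ∑ t, P' 1 true t = π1 * q1 := by rw [← r1t, ← hSY', pSY]
  have t1f : ∑ t, P' 1 false t = π1 * (1 - q1) := by rw [← r1f, ← hSY', pSY]
  rw [Finset.sum_add_distrib, ← Finset.mul_sum, ← Finset.mul_sum, Finset.sum_sub_distrib,
    Finset.sum_sub_distrib, ← Finset.mul_sum, ← Finset.mul_sum, ← Finset.sum_div,
    ← Finset.sum_div, ← Finset.sum_div, ← Finset.sum_div, t0t, t0f, t1t, t1f]
  field_simp

end IPPaper
end
end

section
/- Let P(S,Y,T) be an ε-IP Blackwell optimal information structure, enumerate 𝒮 = {s₁,…,s_n} in decreasing order of q_{s_j} = P(Y=1|S=s_j), and suppose there is exactly one signal t⁺∈𝒯 with P(T=t⁺)>0 and P(Y=1|T=t⁺)=1, and exactly one signal t⁻∈𝒯 with P(T=t⁻)>0 and P(Y=1|T=t⁻)=0. Then P(T=t⁺|S=s_n) = q_{s_n} and P(T=t⁻|S=s₁) = 1 − q_{s₁}. -/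
open Real
open scoped Classical

noncomputable section

namespace IPPaper

section

open Filter Topology

lemma sum_bool_eq (y₀ : Bool) (f : Bool → ℝ) : ∑ y, f y = f y₀ + f (!y₀) := by
  cases y₀ <;> simp [add_comm]

section Dominance

variable {T T₁ T₂ : Type} [Fintype T] [Fintype T₁] [Fintype T₂]

/-- The functional `Σ_t |Q(y₀,t) - κ Q(¬y₀,t)|` decreases under garbling. -/
lemma BlackwellDom.sum_abs_le {Q₁ : Bool → T₁ → ℝ} {Q₂ : Bool → T₂ → ℝ}
    (h : BlackwellDom Q₁ Q₂) (y₀ : Bool) (κ : ℝ) :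
    ∑ t, |Q₂ y₀ t - κ * Q₂ (!y₀) t| ≤ ∑ t, |Q₁ y₀ t - κ * Q₁ (!y₀) t| := by
  obtain ⟨G, hG, hG1, hQ⟩ := h
  calc ∑ t, |Q₂ y₀ t - κ * Q₂ (!y₀) t|
      = ∑ t, |∑ a, (Q₁ y₀ a - κ * Q₁ (!y₀) a) * G a t| := by
        refine Finset.sum_congr rfl fun t _ => ?_
        rw [hQ, hQ, Finset.mul_sum, ← Finset.sum_sub_distrib]
        congr 1
        exact Finset.sum_congr rfl fun a _ => by ring
    _ ≤ ∑ t, ∑ a, |Q₁ y₀ a - κ * Q₁ (!y₀) a| * G a t := by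
        refine Finset.sum_le_sum fun t _ => (Finset.abs_sum_le_sum_abs _ _).trans_eq ?_
        exact Finset.sum_congr rfl fun a _ => by rw [abs_mul, abs_of_nonneg (hG a t)]
    _ = ∑ a, |Q₁ y₀ a - κ * Q₁ (!y₀) a| := by
        rw [Finset.sum_comm]
        exact Finset.sum_congr rfl fun a _ => by rw [← Finset.mul_sum, hG1, mul_one]

/-- Garbling that only mixes the two signals `t₁` and `t₂`. -/
lemma blackwellDom_of_mix {Q₁ Q₂ : Bool → T → ℝ} {t₁ t₂ : T} (hne : t₁ ≠ t₂) {u v : ℝ}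
    (hu : 0 ≤ u) (hu1 : u ≤ 1) (hv : 0 ≤ v) (hv1 : v ≤ 1)
    (h₁ : ∀ y, Q₂ y t₁ = (1 - u) * Q₁ y t₁ + v * Q₁ y t₂)
    (h₂ : ∀ y, Q₂ y t₂ = u * Q₁ y t₁ + (1 - v) * Q₁ y t₂)
    (h : ∀ y t, t ≠ t₁ → t ≠ t₂ → Q₂ y t = Q₁ y t) : BlackwellDom Q₁ Q₂ := by
  set c : T → ℝ := fun a => (if a = t₁ then u else 0) - (if a = t₂ then v else 0) with hc
  set d : T → ℝ := fun b => (if b = t₂ then 1 else 0) - (if b = t₁ then 1 else 0) with hd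
  refine ⟨fun a b => (if a = b then 1 else 0) + c a * d b, fun a b => ?_, fun a => ?_,
    fun y b => ?_⟩
  · simp only [hc, hd]
    by_cases h1 : a = t₁
    · subst h1
      by_cases h2 : b = t₂
      · subst h2; simp [hne, hne.symm, hu]
      · by_cases h3 : b = a
        · subst h3; simp [hne, hu1]
        · simp [h2, h3, Ne.symm h3]
    · by_cases h2 : a = t₂
      · subst h2
        by_cases h3 : b = t₁
        · subst h3; simp [hne, hne.symm, hv]
        · by_cases h4 : b = a
          · subst h4; simp [h1, hv1]
          · simp [h3, h4, Ne.symm h4]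
      · simp only [h1, h2, if_false, sub_zero, zero_mul, add_zero]
        split_ifs <;> norm_num
  · simp [hd, Finset.sum_add_distrib, ← Finset.mul_sum]
  · have : ∑ a, Q₁ y a * ((if a = b then 1 else 0) + c a * d b)
        = Q₁ y b + (u * Q₁ y t₁ - v * Q₁ y t₂) * d b := by
      simp only [hc, mul_add, Finset.sum_add_distrib, sub_mul, mul_sub, Finset.sum_sub_distrib]
      simp
      ring
    rw [this]
    simp only [hd]
    by_cases h1 : b = t₁
    · subst h1; rw [h₁]; simp [hne]; ring
    · by_cases h2 : b = t₂
      · subst h2; rw [h₂]; simp [h1]; ring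
      · rw [h y b h1 h2]; simp [h1, h2]

end Dominance

section Structures

variable {S T : Type} [Fintype S] [Fintype T]

/-- Optimality among ε-IP structures with the same signal set. -/
def OptimalOn (ε : ℝ) (P : S → Bool → T → ℝ) : Prop :=
  ∀ P' : S → Bool → T → ℝ, (∀ s y t, 0 ≤ P' s y t) → IsIP ε P' →
    (∀ s y, pSY P' s y = pSY P s y) → BlackwellDom (pYT P') (pYT P) →
    BlackwellDom (pYT P) (pYT P')

lemma BlackwellOptimal.optimalOn {ε : ℝ} {P : S → Bool → T → ℝ} (h : BlackwellOptimal ε P) :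
    OptimalOn ε P := by
  obtain ⟨⟨-, hsum, hpos⟩, -, hno⟩ := h
  intro P' hnn hip hSY hdom
  by_contra hrev
  set f := Fintype.equivFin T
  set P'' : S → Bool → Fin (Fintype.card T) → ℝ := fun s y i => P' s y (f.symm i) with hP''
  have hSY' : ∀ s y, pSY P'' s y = pSY P' s y := fun s y =>
    Equiv.sum_comp f.symm (fun t => P' s y t)
  have hS' : ∀ s, pS P'' s = pS P' s := fun s => Finset.sum_congr rfl fun y _ => hSY' s y
  have hS : ∀ s, pS P' s = pS P s := fun s => Finset.sum_congr rfl fun y _ => hSY s y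
  refine hno ⟨_, P'', ⟨fun s y i => hnn _ _ _, ?_, fun s => ?_⟩, fun s₁ s₂ i => ?_,
    fun s y => (hSY' s y).trans (hSY s y), ?_, fun hd => hrev ?_⟩
  · rw [← hsum]
    exact Finset.sum_congr rfl fun s _ => (hS' s).trans (hS s)
  · rw [hS', hS]; exact hpos s
  · have := hip s₁ s₂ (f.symm i)
    simp only [condTS, hS'] at this ⊢
    exact this
  · obtain ⟨G, hG, hG1, hQ⟩ := hdom
    refine ⟨fun i b => G (f.symm i) b, fun i b => hG _ _, fun i => hG1 _, fun y b => ?_⟩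
    rw [hQ]
    exact (Equiv.sum_comp f.symm (fun t => pYT P' y t * G t b)).symm
  · obtain ⟨G, hG, hG1, hQ⟩ := hd
    refine ⟨fun a t => G a (f t), fun a t => hG _ _, fun a => ?_, fun y t => ?_⟩
    · rw [← hG1 a]; exact Equiv.sum_comp f (fun i => G a i)
    · rw [← hQ y (f t)]; simp [pYT, hP'']

lemma OptimalOn.congr {ε : ℝ} {P P' : S → Bool → T → ℝ} (h : OptimalOn ε P)
    (hSY : ∀ s y, pSY P' s y = pSY P s y) (hYT : pYT P' = pYT P) : OptimalOn ε P' := by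
  intro P'' hnn hip hS hd
  rw [hYT] at hd ⊢
  exact h P'' hnn hip (fun s y => (hS s y).trans (hSY s y)) hd

lemma eventually_nonneg_add_mul {a d : ℝ} (ha : 0 ≤ a) (h : 0 < a ∨ 0 ≤ d) :
    ∀ᶠ δ in 𝓝[>] (0 : ℝ), 0 ≤ a + δ * d := by
  rcases h with h | h
  · have hc : Tendsto (fun δ : ℝ => a + δ * d) (𝓝[>] 0) (𝓝 (a + 0 * d)) :=
      (Continuous.tendsto (by fun_prop) 0).mono_left nhdsWithin_le_nhds
    rw [zero_mul, add_zero] at hc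
    exact (hc.eventually (lt_mem_nhds h)).mono fun _ h => h.le
  · filter_upwards [self_mem_nhdsWithin] with δ hδ
    exact add_nonneg ha (mul_nonneg (le_of_lt hδ) h)

/-- Moving `P` a small distance in the direction `D`. -/
def perturb (P D : S → Bool → T → ℝ) (δ : ℝ) : S → Bool → T → ℝ :=
  fun s y t => P s y t + δ * D s y t

omit [Fintype S] in
lemma pSY_perturb {P D : S → Bool → T → ℝ} (δ : ℝ) (hD : ∀ s y, pSY D s y = 0) (s : S)
    (y : Bool) : pSY (perturb P D δ) s y = pSY P s y := by
  have := hD s y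
  simp only [pSY, perturb, Finset.sum_add_distrib, ← Finset.mul_sum] at this ⊢
  rw [this]; ring

omit [Fintype T] in
lemma pYT_perturb (P D : S → Bool → T → ℝ) (δ : ℝ) (y : Bool) (t : T) :
    pYT (perturb P D δ) y t = pYT P y t + δ * pYT D y t := by
  simp only [pYT, perturb, Finset.sum_add_distrib, Finset.mul_sum]

lemma eventually_feasible {ε : ℝ} {P D : S → Bool → T → ℝ} (hnn : ∀ s y t, 0 ≤ P s y t)
    (hip : IsIP ε P) (hD : ∀ s y, pSY D s y = 0)
    (hpos : ∀ s y t, 0 < P s y t ∨ 0 ≤ D s y t)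
    (hdir : ∀ s₁ s₂ t, condTS P t s₁ < exp ε * condTS P t s₂ ∨
      pST D s₁ t / pS P s₁ ≤ exp ε * (pST D s₂ t / pS P s₂)) :
    ∀ᶠ δ in 𝓝[>] (0 : ℝ), (∀ s y t, 0 ≤ perturb P D δ s y t) ∧ IsIP ε (perturb P D δ) := by
  have h1 : ∀ᶠ δ in 𝓝[>] (0 : ℝ), ∀ s y t, 0 ≤ perturb P D δ s y t := by
    simp only [eventually_all]
    exact fun s y t => eventually_nonneg_add_mul (hnn s y t) (hpos s y t)
  have h2 : ∀ᶠ δ in 𝓝[>] (0 : ℝ), ∀ s₁ s₂ t,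
      0 ≤ (exp ε * condTS P t s₂ - condTS P t s₁) +
        δ * (exp ε * (pST D s₂ t / pS P s₂) - pST D s₁ t / pS P s₁) := by
    simp only [eventually_all]
    refine fun s₁ s₂ t => eventually_nonneg_add_mul (sub_nonneg.2 (hip s₁ s₂ t)) ?_
    exact (hdir s₁ s₂ t).imp sub_pos.2 sub_nonneg.2
  filter_upwards [h1, h2] with δ h1 h2
  refine ⟨h1, fun s₁ s₂ t => ?_⟩
  have hS : ∀ s, pS (perturb P D δ) s = pS P s := fun s =>
    Finset.sum_congr rfl fun y _ => pSY_perturb δ hD s y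
  have hc : ∀ s, condTS (perturb P D δ) t s = condTS P t s + δ * (pST D s t / pS P s) := by
    intro s
    have : pST (perturb P D δ) s t = pST P s t + δ * pST D s t := by
      simp only [pST, perturb, Finset.sum_add_distrib, Finset.mul_sum]
    rw [condTS, this, hS, condTS]; ring
  rw [hc, hc]
  linarith [h2 s₁ s₂ t]

/-- A strict Blackwell improvement mixing two signals is impossible at an optimum. -/
lemma OptimalOn.false_of_mix {ε : ℝ} {P P' : S → Bool → T → ℝ} (h : OptimalOn ε P)
    (hnn : ∀ s y t, 0 ≤ P' s y t) (hip : IsIP ε P') (hSY : ∀ s y, pSY P' s y = pSY P s y)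
    {t₁ t₂ : T} (hne : t₁ ≠ t₂) {u v : ℝ}
    (hu : 0 ≤ u) (hu1 : u ≤ 1) (hv : 0 ≤ v) (hv1 : v ≤ 1)
    (h₁ : ∀ y, pYT P y t₁ = (1 - u) * pYT P' y t₁ + v * pYT P' y t₂)
    (h₂ : ∀ y, pYT P y t₂ = u * pYT P' y t₁ + (1 - v) * pYT P' y t₂)
    (hr : ∀ y t, t ≠ t₁ → t ≠ t₂ → pYT P y t = pYT P' y t) (y₀ : Bool) (κ : ℝ)
    (hlt : |pYT P y₀ t₁ - κ * pYT P (!y₀) t₁| + |pYT P y₀ t₂ - κ * pYT P (!y₀) t₂| <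
      |pYT P' y₀ t₁ - κ * pYT P' (!y₀) t₁| + |pYT P' y₀ t₂ - κ * pYT P' (!y₀) t₂|) : False := by
  have hd := h P' hnn hip hSY (blackwellDom_of_mix hne hu hu1 hv hv1 h₁ h₂ hr)
  refine (hd.sum_abs_le y₀ κ).not_gt ?_
  rw [← Finset.sum_erase_add _ _ (Finset.mem_univ t₁),
    ← Finset.sum_erase_add _ _ (Finset.mem_univ t₁),
    ← Finset.sum_erase_add _ _ (Finset.mem_erase.2 ⟨hne.symm, Finset.mem_univ t₂⟩),
    ← Finset.sum_erase_add _ _ (Finset.mem_erase.2 ⟨hne.symm, Finset.mem_univ t₂⟩)]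
  have : ∑ t ∈ (Finset.univ.erase t₁).erase t₂, |pYT P y₀ t - κ * pYT P (!y₀) t| =
      ∑ t ∈ (Finset.univ.erase t₁).erase t₂, |pYT P' y₀ t - κ * pYT P' (!y₀) t| := by
    refine Finset.sum_congr rfl fun t ht => ?_
    simp only [Finset.mem_erase, Finset.mem_univ, and_true] at ht
    rw [hr _ t ht.2 ht.1, hr _ t ht.2 ht.1]
  linarith

/-- At an optimum no secret mixes both outcomes against the order of the posteriors. -/
lemma OptimalOn.eq_zero_of_le {ε : ℝ} {P : S → Bool → T → ℝ} (h : OptimalOn ε P)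
    (hnn : ∀ s y t, 0 ≤ P s y t) (hip : IsIP ε P) {y₀ : Bool} {t₁ t₂ : T} (hne : t₁ ≠ t₂)
    (hle : pYT P y₀ t₁ * pYT P (!y₀) t₂ ≤ pYT P y₀ t₂ * pYT P (!y₀) t₁) {s₀ : S}
    (hA : 0 < P s₀ y₀ t₁) : P s₀ (!y₀) t₂ = 0 := by
  by_contra hB
  replace hB : 0 < P s₀ (!y₀) t₂ := lt_of_le_of_ne (hnn _ _ _) (Ne.symm hB)
  set D : S → Bool → T → ℝ := fun s y t => (if s = s₀ then 1 else 0) *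
    ((if y = y₀ then 1 else -1) * ((if t = t₂ then 1 else 0) - (if t = t₁ then 1 else 0))) with hDdef
  have hne' : (!y₀) ≠ y₀ := by cases y₀ <;> simp
  have hDSY : ∀ s y, pSY D s y = 0 := by
    intro s y; simp [pSY, hDdef]
  have hDST : ∀ s t, pST D s t = 0 := by
    intro s t; rw [pST, sum_bool_eq y₀]; simp only [hDdef, hne', if_true, if_false]; ring
  have hDYT : ∀ y t, pYT D y t = (if y = y₀ then 1 else -1) *
      ((if t = t₂ then 1 else 0) - (if t = t₁ then 1 else 0)) := by
    intro y t; simp [pYT, hDdef]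
  have hev := eventually_feasible (D := D) hnn hip hDSY (fun s y t => ?_) (fun s₁ s₂ t => ?_)
  rotate_left
  · by_cases hs : s = s₀
    · subst hs
      rcases Bool.eq_or_eq_not y y₀ with rfl | rfl
      · by_cases ht : t = t₁
        · subst ht; exact Or.inl hA
        · right; simp only [hDdef, ht]; simp; split_ifs <;> norm_num
      · by_cases ht : t = t₂
        · subst ht; exact Or.inl hB
        · right; simp only [hDdef, ht, hne']; simp; split_ifs <;> norm_num
    · right; simp [hDdef, hs]
  · right; simp [hDST]
  obtain ⟨δ, ⟨hnn', hip'⟩, hδ⟩ := (hev.and self_mem_nhdsWithin).exists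
  replace hδ : 0 < δ := hδ
  have nnYT : ∀ y t, 0 ≤ pYT P y t := fun y t => Finset.sum_nonneg fun s _ => hnn s y t
  have hb2 : 0 < pYT P (!y₀) t₂ :=
    hB.trans_le (Finset.single_le_sum (f := fun s => P s (!y₀) t₂) (fun s _ => hnn s _ _)
      (Finset.mem_univ s₀))
  have ha1 : 0 < pYT P y₀ t₁ :=
    hA.trans_le (Finset.single_le_sum (f := fun s => P s y₀ t₁) (fun s _ => hnn s _ _)
      (Finset.mem_univ s₀))
  have e1 : pYT (perturb P D δ) y₀ t₁ = pYT P y₀ t₁ - δ := by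
    rw [pYT_perturb, hDYT]; simp [hne]; ring
  have e2 : pYT (perturb P D δ) y₀ t₂ = pYT P y₀ t₂ + δ := by
    rw [pYT_perturb, hDYT]; simp [hne.symm]
  have e3 : pYT (perturb P D δ) (!y₀) t₁ = pYT P (!y₀) t₁ + δ := by
    rw [pYT_perturb, hDYT]; simp [hne, hne']
  have e4 : pYT (perturb P D δ) (!y₀) t₂ = pYT P (!y₀) t₂ - δ := by
    rw [pYT_perturb, hDYT]; simp [hne.symm, hne']; ring
  have e5 : ∀ y t, t ≠ t₁ → t ≠ t₂ → pYT P y t = pYT (perturb P D δ) y t := by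
    intro y t h1 h2; rw [pYT_perturb, hDYT]; simp [h1, h2]
  have na2 := nnYT y₀ t₂
  have nb1 := nnYT (!y₀) t₁
  set a₁ := pYT P y₀ t₁ with ha₁
  set a₂ := pYT P y₀ t₂ with ha₂
  set b₁ := pYT P (!y₀) t₁ with hb₁
  set b₂ := pYT P (!y₀) t₂ with hb₂
  set N := δ * ((a₁ + b₁) + (a₂ + b₂)) + (a₂ * b₁ - a₁ * b₂) with hN
  have hNpos : 0 < N := by
    have : 0 < δ * ((a₁ + b₁) + (a₂ + b₂)) := by positivity
    linarith
  set k := δ / N with hk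
  have hkN : k * (δ * ((a₁ + b₁) + (a₂ + b₂)) + (a₂ * b₁ - a₁ * b₂)) = δ := by
    rw [← hN, hk, div_mul_cancel₀ _ hNpos.ne']
  have hkpos : 0 < k := div_pos hδ hNpos
  have hk1 : ∀ m, 0 ≤ m → m ≤ (a₁ + b₁) + (a₂ + b₂) → k * m ≤ 1 := by
    intro m _ hm
    rw [hk, div_mul_eq_mul_div, div_le_one hNpos]
    have := mul_le_mul_of_nonneg_left hm hδ.le
    linarith
  refine h.false_of_mix hnn' hip' (pSY_perturb δ hDSY) hne
    (u := k * (a₂ + b₂)) (v := k * (a₁ + b₁)) (by positivity) (hk1 _ (by positivity) (by linarith))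
    (by positivity) (hk1 _ (by positivity) (by linarith)) (fun y => ?_) (fun y => ?_) e5 y₀
    (a₂ / b₂) ?_
  · rcases Bool.eq_or_eq_not y y₀ with rfl | rfl
    · rw [e1, e2, ← ha₁]; linear_combination (-1) * hkN
    · rw [e3, e4, ← hb₁]; linear_combination hkN
  · rcases Bool.eq_or_eq_not y y₀ with rfl | rfl
    · rw [e1, e2, ← ha₂]; linear_combination hkN
    · rw [e3, e4, ← hb₂]; linear_combination (-1) * hkN
  · rw [e1, e2, e3, e4]
    have hκ : 0 ≤ a₂ / b₂ := by positivity
    have hκb : a₂ / b₂ * b₂ = a₂ := div_mul_cancel₀ _ hb2.ne'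
    have hx : a₁ ≤ a₂ / b₂ * b₁ := by
      rw [div_mul_eq_mul_div, le_div_iff₀ hb2]; exact hle
    generalize a₂ / b₂ = κ at *
    have hδκ : 0 ≤ δ * κ := by positivity
    rw [abs_of_nonpos (by linarith), abs_of_nonneg (by linarith), abs_of_nonpos (by linarith),
      abs_of_nonneg (by linarith)]
    linarith

/-- If every secret has mass on `y₀` in a signal `t` that does not reveal `y₀`, part of that mass
can be moved to a signal `τ` that does. -/
lemma OptimalOn.exists_eq_zero {ε : ℝ} {P : S → Bool → T → ℝ} (h : OptimalOn ε P)
    (hnn : ∀ s y t, 0 ≤ P s y t) (hip : IsIP ε P)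
    {y₀ : Bool} {t τ : T} (hne : t ≠ τ) (hτ : pYT P (!y₀) τ = 0) (hb : 0 < pYT P (!y₀) t) :
    ∃ s, P s y₀ t = 0 := by
  by_contra! hA
  replace hA : ∀ s, 0 < P s y₀ t := fun s => lt_of_le_of_ne (hnn _ _ _) (hA s).symm
  have hne' : (!y₀) ≠ y₀ := by cases y₀ <;> simp
  set D : S → Bool → T → ℝ := fun s y w => (if y = y₀ then 1 else 0) *
    (pST P s t * ((if w = τ then 1 else 0) - (if w = t then 1 else 0))) with hDdef
  set m : ℝ := ∑ s, pST P s t with hm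
  have hc0 : ∀ s w, 0 ≤ pST P s w := fun s w => Finset.sum_nonneg fun y _ => hnn _ _ _
  have hDSY : ∀ s y, pSY D s y = 0 := by
    intro s y; simp [pSY, hDdef, ← Finset.mul_sum]
  have hDST : ∀ s w, pST D s w =
      pST P s t * ((if w = τ then 1 else 0) - (if w = t then 1 else 0)) := by
    intro s w; rw [pST, sum_bool_eq y₀]; simp only [hDdef, hne', if_true, if_false]; ring
  have hDYT : ∀ y w, pYT D y w = (if y = y₀ then 1 else 0) *
      (m * ((if w = τ then 1 else 0) - (if w = t then 1 else 0))) := by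
    intro y w; simp only [pYT, hDdef, hm, Finset.mul_sum, Finset.sum_mul]
  have hev := eventually_feasible (D := D) hnn hip hDSY (fun s y w => ?_) (fun s₁ s₂ w => ?_)
  rotate_left
  · rcases Bool.eq_or_eq_not y y₀ with rfl | rfl
    · by_cases hw : w = t
      · subst hw; exact Or.inl (hA s)
      · right
        simp only [hDdef, hw, if_true, if_false, one_mul, sub_zero]
        exact mul_nonneg (hc0 _ _) (by split_ifs <;> norm_num)
    · right; simp [hDdef, hne']
  · simp only [hDST]
    by_cases hw : w = t
    · subst hw
      rcases (hip s₁ s₂ w).lt_or_eq with hlt | heq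
      · exact Or.inl hlt
      · right
        simp only [condTS] at heq
        simp only [hne, if_true, if_false, zero_sub, mul_neg, mul_one, neg_div]
        linarith
    · right
      have := hip s₁ s₂ t
      simp only [condTS] at this
      simp only [hw, if_false, sub_zero]
      split_ifs
      · simpa using this
      · simp
  obtain ⟨δ, ⟨hnn', hip'⟩, hδ⟩ := (hev.and self_mem_nhdsWithin).exists
  replace hδ : 0 < δ := hδ
  have hmpos : 0 < m := by
    have : m = pYT P y₀ t + pYT P (!y₀) t := by
      simp only [hm, pST, pYT, sum_bool_eq y₀, Finset.sum_add_distrib]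
    rw [this]
    exact add_pos_of_nonneg_of_pos (Finset.sum_nonneg fun s _ => hnn _ _ _) hb
  have hp : 0 ≤ pYT P y₀ τ := Finset.sum_nonneg fun s _ => hnn _ _ _
  have e1 : pYT (perturb P D δ) y₀ τ = pYT P y₀ τ + δ * m := by
    rw [pYT_perturb, hDYT]; simp [hne.symm]
  have e2 : pYT (perturb P D δ) y₀ t = pYT P y₀ t - δ * m := by
    rw [pYT_perturb, hDYT]; simp [hne]; ring
  have e3 : ∀ w, pYT (perturb P D δ) (!y₀) w = pYT P (!y₀) w := by
    intro w; rw [pYT_perturb, hDYT]; simp [hne']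
  have e5 : ∀ y w, w ≠ τ → w ≠ t → pYT P y w = pYT (perturb P D δ) y w := by
    intro y w h1 h2; rw [pYT_perturb, hDYT]; simp [h1, h2]
  have hδm : 0 < δ * m := mul_pos hδ hmpos
  have hden : 0 < pYT P y₀ τ + δ * m := by linarith
  have hu : δ * m / (pYT P y₀ τ + δ * m) * (pYT P y₀ τ + δ * m) = δ * m :=
    div_mul_cancel₀ _ hden.ne'
  refine h.false_of_mix hnn' hip' (pSY_perturb δ hDSY) hne.symm
    (u := δ * m / (pYT P y₀ τ + δ * m)) (v := 0) (by positivity)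
    ((div_le_one hden).2 (by linarith)) le_rfl zero_le_one (fun y => ?_) (fun y => ?_) e5 y₀
    (pYT P y₀ t / pYT P (!y₀) t) ?_
  · rcases Bool.eq_or_eq_not y y₀ with rfl | rfl
    · rw [e1]; linear_combination hu
    · rw [e3, hτ]; ring
  · rcases Bool.eq_or_eq_not y y₀ with rfl | rfl
    · rw [e1, e2]; linear_combination -hu
    · rw [e3, e3, hτ]; ring
  · have hκb : pYT P y₀ t / pYT P (!y₀) t * pYT P (!y₀) t = pYT P y₀ t :=
      div_mul_cancel₀ _ hb.ne'
    rw [e1, e2, e3, e3, hτ, hκb, mul_zero, sub_zero, sub_zero, sub_self, abs_zero,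
      abs_of_nonneg hp, abs_of_pos hden, abs_of_neg (by linarith)]
    linarith

omit [Fintype S] in
lemma lt_or_le_of_lt {E : ℝ} (hE : 0 < E) {c d : S → ℝ} (hc : ∀ s₁ s₂, c s₁ ≤ E * c s₂)
    {r z : S} (hrz : c r < c z) (hr : ∀ s, s ≠ r → d s ≤ 0) (hz : ∀ s, s ≠ z → 0 ≤ d s)
    (s₁ s₂ : S) : c s₁ < E * c s₂ ∨ d s₁ ≤ E * d s₂ := by
  by_cases h1 : s₁ = r
  · subst h1; exact Or.inl (hrz.trans_le (hc _ _))
  · by_cases h2 : s₂ = z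
    · subst h2; exact Or.inl ((hc _ r).trans_lt (mul_lt_mul_of_pos_left hrz hE))
    · exact Or.inr ((hr _ h1).trans (mul_nonneg hE.le (hz _ h2)))

omit [Fintype S] in
lemma IsIP.condTS_pos {ε : ℝ} {P : S → Bool → T → ℝ} (hip : IsIP ε P) {s : S} {t : T}
    (h : 0 < condTS P t s) (s' : S) : 0 < condTS P t s' :=
  pos_of_mul_pos_right (h.trans_le (hip s s' t)) (exp_pos ε).le

/-- Exchanging mass between the secrets `r` and `z` without affecting the joint law of `(Y,T)`. -/
lemma exists_exchange {ε : ℝ} {P : S → Bool → T → ℝ} (hnn : ∀ s y t, 0 ≤ P s y t)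
    (hip : IsIP ε P) (hS : ∀ s, 0 < pS P s) {y₀ : Bool} {t t' τ : T} {r z : S}
    (htτ : t ≠ τ) (ht'τ : t' ≠ τ)
    (hτ : condTS P τ r < condTS P τ z) (ht' : condTS P t' z < condTS P t' r)
    (hzτ : 0 < P z y₀ τ) (hrt : 0 < P r y₀ t)
    (hB : t ≠ t' → 0 < P r (!y₀) t' ∧ 0 < P z (!y₀) t) :
    ∃ P' : S → Bool → T → ℝ, (∀ s y t, 0 ≤ P' s y t) ∧ IsIP ε P' ∧
      (∀ s y, pSY P' s y = pSY P s y) ∧ pYT P' = pYT P ∧ 0 < P' r y₀ t ∧ 0 < P' z y₀ t ∧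
      ∀ s, s ≠ r → s ≠ z → P' s = P s := by
  have hrz : r ≠ z := by rintro rfl; exact hτ.false
  have hne' : (!y₀) ≠ y₀ := by cases y₀ <;> simp
  set ρ : S → ℝ := fun s => (if s = r then 1 else 0) - (if s = z then 1 else 0) with hρ
  set D : S → Bool → T → ℝ := fun s y w => ρ s * (if y = y₀ then
    (if w = τ then 1 else 0) - (if w = t then 1 else 0) else
    (if w = t then 1 else 0) - (if w = t' then 1 else 0)) with hDdef
  have hρr : ρ r = 1 := by simp [hρ, hrz]
  have hρz : ρ z = -1 := by simp [hρ, hrz.symm]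
  have hρ0 : ∀ s, s ≠ r → s ≠ z → ρ s = 0 := by intro s h1 h2; simp [hρ, h1, h2]
  have hDSY : ∀ s y, pSY D s y = 0 := by
    intro s y
    simp only [pSY, hDdef, ← Finset.mul_sum]
    split_ifs <;> simp
  have hDST : ∀ s w, pST D s w = ρ s * ((if w = τ then 1 else 0) - (if w = t' then 1 else 0)) := by
    intro s w; rw [pST, sum_bool_eq y₀]; simp only [hDdef, hne', if_true, if_false]; ring
  have hDYT : ∀ y w, pYT D y w = 0 := by
    intro y w; simp only [pYT, hDdef, ← Finset.sum_mul]; simp [hρ]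
  have hρle : ∀ s, s ≠ r → ρ s ≤ 0 := by
    intro s h1; simp only [hρ, h1, if_false]; split_ifs <;> norm_num
  have hρge : ∀ s, s ≠ z → 0 ≤ ρ s := by
    intro s h1; simp only [hρ, h1, if_false]; split_ifs <;> norm_num
  have hev := eventually_feasible (D := D) hnn hip hDSY (fun s y w => ?_) (fun s₁ s₂ w => ?_)
  rotate_left
  · by_cases hsr : s = r
    · subst hsr
      simp only [hDdef, hρr, one_mul]
      rcases Bool.eq_or_eq_not y y₀ with rfl | rfl
      · by_cases hw : w = t
        · subst hw; exact Or.inl hrt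
        · right; simp only [hw, if_true, if_false]; split_ifs <;> norm_num
      · simp only [hne', if_false]
        by_cases htt : t = t'
        · right; simp [htt]
        · by_cases hw : w = t'
          · subst hw; exact Or.inl (hB htt).1
          · right; simp only [hw, if_false]; split_ifs <;> norm_num
    · by_cases hsz : s = z
      · subst hsz
        simp only [hDdef, hρz]
        rcases Bool.eq_or_eq_not y y₀ with rfl | rfl
        · by_cases hw : w = τ
          · subst hw; exact Or.inl hzτ
          · right; simp only [hw, if_true, if_false]; split_ifs <;> norm_num
        · simp only [hne', if_false]
          by_cases htt : t = t'
          · right; simp [htt]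
          · by_cases hw : w = t
            · subst hw; exact Or.inl (hB htt).2
            · right; simp only [hw, if_false]; split_ifs <;> norm_num
      · right; simp [hDdef, hρ0 s hsr hsz]
  · simp only [hDST]
    by_cases hw : w = τ
    · subst hw
      refine lt_or_le_of_lt (exp_pos ε) (c := fun s => condTS P w s)
        (d := fun s => ρ s * ((if w = w then 1 else 0) - (if w = t' then 1 else 0)) / pS P s)
        (fun s₁ s₂ => hip s₁ s₂ w) hτ (fun s hs => ?_) (fun s hs => ?_) s₁ s₂
      · simp only [ht'τ.symm, if_true, if_false, sub_zero, mul_one]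
        exact div_nonpos_of_nonpos_of_nonneg (hρle s hs) (hS s).le
      · simp only [ht'τ.symm, if_true, if_false, sub_zero, mul_one]
        exact div_nonneg (hρge s hs) (hS s).le
    · by_cases hw' : w = t'
      · subst hw'
        refine lt_or_le_of_lt (exp_pos ε) (c := fun s => condTS P w s)
          (d := fun s => ρ s * ((if w = τ then 1 else 0) - (if w = w then 1 else 0)) / pS P s)
          (fun s₁ s₂ => hip s₁ s₂ w) ht' (fun s hs => ?_) (fun s hs => ?_) s₁ s₂
        · simp only [hw, if_true, if_false, zero_sub, mul_neg, mul_one]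
          exact div_nonpos_of_nonpos_of_nonneg (neg_nonpos.2 (hρge s hs)) (hS s).le
        · simp only [hw, if_true, if_false, zero_sub, mul_neg, mul_one]
          exact div_nonneg (neg_nonneg.2 (hρle s hs)) (hS s).le
      · right; simp [hw, hw']
  have hev' : ∀ᶠ δ in 𝓝[>] (0 : ℝ), δ < P r y₀ t :=
    (gt_mem_nhds hrt).filter_mono nhdsWithin_le_nhds
  obtain ⟨δ, ⟨⟨hnn', hip'⟩, hδr⟩, hδ⟩ := ((hev.and hev').and self_mem_nhdsWithin).exists
  replace hδ : 0 < δ := hδ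
  refine ⟨perturb P D δ, hnn', hip', pSY_perturb δ hDSY, ?_, ?_, ?_, fun s h1 h2 => ?_⟩
  · funext y w; rw [pYT_perturb, hDYT, mul_zero, add_zero]
  · simp only [perturb, hDdef, hρr, htτ, if_true, if_false]; linarith
  · simp only [perturb, hDdef, hρz, htτ, if_true, if_false]; linarith [hnn z y₀ t]
  · funext y w; simp [perturb, hDdef, hρ0 s h1 h2]

/-- At an optimum, the secret least favourable to `y₀` has all of its `y₀`-mass in the signal `τ`
revealing `y₀`. -/
lemma OptimalOn.eq_zero_of_ne {ε : ℝ} {y₀ : Bool} {τ : T} {r : S}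
    {P : S → Bool → T → ℝ} (hnn : ∀ s y t, 0 ≤ P s y t) (hip : IsIP ε P) (hopt : OptimalOn ε P)
    (hS : ∀ s, 0 < pS P s) (hτ : pYT P (!y₀) τ = 0)
    (huniq : ∀ t, 0 < pYT P y₀ t → pYT P (!y₀) t = 0 → t = τ)
    (hmin : ∀ s, pSY P r y₀ / pS P r ≤ pSY P s y₀ / pS P s) :
    ∀ t, t ≠ τ → P r y₀ t = 0 := by
  induction hk : (Finset.univ.filter fun s => ∀ t, t ≠ τ → P s y₀ t = 0).card using
    Nat.strong_induction_on generalizing P with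
  | _ k ih =>
  by_contra! hr
  obtain ⟨t₀, ht₀τ, ht₀⟩ := hr
  replace ht₀ : 0 < P r y₀ t₀ := lt_of_le_of_ne (hnn _ _ _) ht₀.symm
  have nnYT : ∀ y t, 0 ≤ pYT P y t := fun y t => Finset.sum_nonneg fun s _ => hnn s y t
  have leYT : ∀ s y t, P s y t ≤ pYT P y t := fun s y t =>
    Finset.single_le_sum (f := fun s => P s y t) (fun s _ => hnn s _ _) (Finset.mem_univ s)
  have hbpos : ∀ s t, t ≠ τ → 0 < P s y₀ t → 0 < pYT P (!y₀) t := fun s t ht hs =>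
    lt_of_le_of_ne (nnYT _ _) fun h0 => ht (huniq t (hs.trans_le (leYT _ _ _)) h0.symm)
  have hST : ∀ s t, pST P s t = P s y₀ t + P s (!y₀) t := fun s t => sum_bool_eq y₀ _
  have hcpos : ∀ s y t, 0 < P s y t → ∀ s', 0 < pST P s' t := by
    intro s y t h s'
    have : 0 < pST P s t := h.trans_le
      (Finset.single_le_sum (f := fun y => P s y t) (fun y _ => hnn s _ _) (Finset.mem_univ y))
    have := hip.condTS_pos (div_pos this (hS s)) s'
    exact (div_pos_iff_of_pos_right (hS s')).1 this
  by_cases hZ : ∃ z, ∀ t, t ≠ τ → P z y₀ t = 0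
  · obtain ⟨z, hz⟩ := hZ
    have hBτ : ∀ s, P s (!y₀) τ = 0 := fun s => le_antisymm (hτ ▸ leYT _ _ _) (hnn _ _ _)
    have hzτ : P z y₀ τ = pSY P z y₀ :=
      (Finset.sum_eq_single τ (fun t _ ht => hz t ht) (by simp)).symm
    have hrτ : P r y₀ τ < pSY P r y₀ := by
      have : ∑ w ∈ {τ, t₀}, P r y₀ w ≤ pSY P r y₀ :=
        Finset.sum_le_univ_sum_of_nonneg fun w => hnn _ _ _
      rw [Finset.sum_pair ht₀τ.symm] at this
      linarith
    have hcτ : condTS P τ r < condTS P τ z := by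
      rw [condTS, condTS, hST, hST, hBτ, hBτ, add_zero, add_zero, hzτ]
      exact ((div_lt_div_iff_of_pos_right (hS r)).2 hrτ).trans_le (hmin z)
    have hsum : ∀ s, ∑ t, condTS P t s = 1 := by
      intro s
      simp only [condTS, ← Finset.sum_div]
      rw [div_eq_one_iff_eq (hS s).ne', pS, Finset.sum_comm]
      rfl
    obtain ⟨t', ht'⟩ : ∃ t', condTS P t' z < condTS P t' r := by
      by_contra! hle
      have := Finset.sum_lt_sum (fun t _ => hle t) ⟨τ, Finset.mem_univ τ, hcτ⟩
      rw [hsum, hsum] at this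
      exact this.false
    have ht'τ : t' ≠ τ := by rintro rfl; exact hcτ.not_gt ht'
    have hzpos : 0 < P z y₀ τ := by
      have h1 : 0 < pSY P r y₀ := (hnn _ _ _).trans_lt hrτ
      have h2 := (div_pos h1 (hS r)).trans_le (hmin z)
      rw [hzτ]
      exact (div_pos_iff_of_pos_right (hS z)).1 h2
    obtain ⟨t, htτ, htr, hB⟩ : ∃ t, t ≠ τ ∧ 0 < P r y₀ t ∧
        (t ≠ t' → 0 < P r (!y₀) t' ∧ 0 < P z (!y₀) t) := by
      rcases (hnn r y₀ t').lt_or_eq with hlt | heq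
      · exact ⟨t', ht'τ, hlt, fun h => absurd rfl h⟩
      · refine ⟨t₀, ht₀τ, ht₀, fun _ => ⟨?_, ?_⟩⟩
        · have h1 : 0 < condTS P t' r :=
            (div_nonneg (Finset.sum_nonneg fun y _ => hnn _ _ _) (hS z).le).trans_lt ht'
          have := (div_pos_iff_of_pos_right (hS r)).1 h1
          rwa [hST, ← heq, zero_add] at this
        · have := hcpos _ _ _ ht₀ z
          rwa [hST, hz _ ht₀τ, zero_add] at this
    obtain ⟨P', hnn', hip', hSY', hYT', hr', hz', hP'⟩ :=
      exists_exchange hnn hip hS htτ ht'τ hcτ ht' hzpos htr hB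
    have hS' : ∀ s, pS P' s = pS P s := fun s => Finset.sum_congr rfl fun y _ => hSY' s y
    refine hr'.ne' (ih _ ?_ hnn' hip' (hopt.congr hSY' hYT') (fun s => (hS' s).symm ▸ hS s)
      (by rw [hYT', hτ]) (by rw [hYT']; exact huniq)
      (fun s => by rw [hS', hS', hSY', hSY']; exact hmin s) rfl t htτ)
    rw [← hk]
    refine Finset.card_lt_card (Finset.ssubset_iff_subset_ne.2 ⟨fun s hs => ?_, fun heq => ?_⟩)
    · simp only [Finset.mem_filter, Finset.mem_univ, true_and] at hs ⊢
      by_cases h1 : s = r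
      · subst h1; exact absurd (hs t htτ) hr'.ne'
      · by_cases h2 : s = z
        · subst h2; exact absurd (hs t htτ) hz'.ne'
        · rwa [hP' s h1 h2] at hs
    · have : z ∈ Finset.univ.filter fun s => ∀ t, t ≠ τ → P' s y₀ t = 0 := by
        rw [heq]; simpa using hz
      simp only [Finset.mem_filter, Finset.mem_univ, true_and] at this
      exact hz'.ne' (this t htτ)
  · push Not at hZ
    obtain ⟨t, ht, hmax⟩ := Finset.exists_max_image
      (Finset.univ.filter fun t => t ≠ τ ∧ 0 < pYT P (!y₀) t)
      (fun t => pYT P y₀ t / pYT P (!y₀) t) ⟨t₀, by simpa using ⟨ht₀τ, hbpos r t₀ ht₀τ ht₀⟩⟩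
    simp only [Finset.mem_filter, Finset.mem_univ, true_and] at ht hmax
    obtain ⟨s, hs⟩ := hopt.exists_eq_zero hnn hip ht.1 hτ ht.2
    obtain ⟨t₁, ht₁τ, ht₁⟩ := hZ s
    replace ht₁ : 0 < P s y₀ t₁ := lt_of_le_of_ne (hnn _ _ _) ht₁.symm
    have hb₁ := hbpos s t₁ ht₁τ ht₁
    have hne : t₁ ≠ t := by rintro rfl; exact ht₁.ne' hs
    have hB := hopt.eq_zero_of_le hnn hip hne
      ((div_le_div_iff₀ hb₁ ht.2).1 (hmax t₁ ⟨ht₁τ, hb₁⟩)) ht₁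
    obtain ⟨s', -, hs'⟩ := Finset.exists_ne_zero_of_sum_ne_zero ht.2.ne'
    have := hcpos s' (!y₀) t (lt_of_le_of_ne (hnn _ _ _) hs'.symm) s
    rw [hST, hs, hB, add_zero] at this
    exact this.false

lemma BlackwellOptimal.condTS_eq {ε : ℝ} {P : S → Bool → T → ℝ} (h : BlackwellOptimal ε P)
    {y₀ : Bool} {τ : T} {r : S} (hτ : pYT P (!y₀) τ = 0)
    (huniq : ∀ t, 0 < pYT P y₀ t → pYT P (!y₀) t = 0 → t = τ)
    (hmin : ∀ s, pSY P r y₀ / pS P r ≤ pSY P s y₀ / pS P s) :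
    condTS P τ r = pSY P r y₀ / pS P r := by
  obtain ⟨⟨hnn, -, hS⟩, hip, -⟩ := id h
  have h0 := h.optimalOn.eq_zero_of_ne hnn hip hS hτ huniq hmin
  have hB : P r (!y₀) τ = 0 := le_antisymm (hτ ▸ Finset.single_le_sum
    (f := fun s => P s (!y₀) τ) (fun s _ => hnn s _ _) (Finset.mem_univ r)) (hnn _ _ _)
  rw [condTS, pST, sum_bool_eq y₀, hB, add_zero, pSY,
    Finset.sum_eq_single τ (fun t _ ht => h0 t ht) (by simp)]

omit [Fintype T] in
lemma pT_eq (P : S → Bool → T → ℝ) (t : T) : pT P t = pYT P true t + pYT P false t := by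
  simp [pT, pYT, Finset.sum_add_distrib]

omit [Fintype S] in
lemma one_sub_qS {P : S → Bool → T → ℝ} {s : S} (h : 0 < pS P s) :
    1 - qS P s = pSY P s false / pS P s := by
  have : pS P s = pSY P s true + pSY P s false := by simp [pS, pSY]
  rw [qS, eq_div_iff h.ne', sub_mul, div_mul_cancel₀ _ h.ne']
  linarith

end Structures

end

/-- in a Blackwell optimal ε-IP structure with a unique fully
revealing positive signal `t⁺` and a unique fully revealing negative signal
`t⁻`, one has `P(T=t⁺|S=s_n) = q_{s_n}` and `P(T=t⁻|S=s₁) = 1 − q_{s₁}`. -/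
theorem statement15 {S T : Type} [Fintype S] [Fintype T]
    (ε : ℝ) (hε : 0 ≤ ε) (P : S → Bool → T → ℝ)
    (hopt : BlackwellOptimal ε P)
    (n : ℕ) (hn : 0 < n) (e : Fin n ≃ S)
    (hord : ∀ i j : Fin n, i ≤ j → qS P (e j) ≤ qS P (e i))
    (tp tm : T)
    (htp : 0 < pT P tp ∧ postYT P tp = 1)
    (htpu : ∀ t, 0 < pT P t → postYT P t = 1 → t = tp)
    (htm : 0 < pT P tm ∧ postYT P tm = 0)
    (htmu : ∀ t, 0 < pT P t → postYT P t = 0 → t = tm) :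
    condTS P tp (e ⟨n - 1, by omega⟩) = qS P (e ⟨n - 1, by omega⟩) ∧
    condTS P tm (e ⟨0, hn⟩) = 1 - qS P (e ⟨0, hn⟩) := by
  obtain ⟨⟨hnn, -, hS⟩, -, -⟩ := id hopt
  have nnYT : ∀ y t, 0 ≤ pYT P y t := fun y t => Finset.sum_nonneg fun s _ => hnn s y t
  have post_one : ∀ t, 0 < pT P t → (postYT P t = 1 ↔ pYT P false t = 0) := by
    intro t ht
    rw [postYT, div_eq_one_iff_eq ht.ne', pT_eq]
    constructor <;> intro h <;> linarith
  have post_zero : ∀ t, 0 < pT P t → (postYT P t = 0 ↔ pYT P true t = 0) := by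
    intro t ht
    rw [postYT, div_eq_zero_iff, or_iff_left ht.ne']
  constructor
  · refine hopt.condTS_eq (y₀ := true) ((post_one tp htp.1).1 htp.2) (fun t h1 h2 => ?_)
      (fun s => ?_)
    · have ht : 0 < pT P t := by rw [pT_eq]; exact add_pos_of_pos_of_nonneg h1 (nnYT _ _)
      exact htpu t ht ((post_one t ht).2 h2)
    · have := hord (e.symm s) ⟨n - 1, by omega⟩ (by rw [Fin.le_def]; simp only; omega)
      rwa [e.apply_symm_apply] at this
  · rw [one_sub_qS (hS _)]
    refine hopt.condTS_eq (y₀ := false) ((post_zero tm htm.1).1 htm.2) (fun t h1 h2 => ?_)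
      (fun s => ?_)
    · have ht : 0 < pT P t := by rw [pT_eq]; exact add_pos_of_nonneg_of_pos (nnYT _ _) h1
      exact htmu t ht ((post_zero t ht).2 h2)
    · rw [← one_sub_qS (hS _), ← one_sub_qS (hS _)]
      have := hord ⟨0, hn⟩ (e.symm s) (by rw [Fin.le_def]; simp)
      rw [e.apply_symm_apply] at this
      linarith

end IPPaper
end
end
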